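/- Recurrence for the finite Euler sum: let E(L) = ∑_{i,j,k≥0} (-1)^j q^{2T_i+2T_j+2T_k-i-j} C_{q²}(L-k, i) C_{q²}(L-i, j) C_{q²}(L-j, k). Then for all L ≥ 0: -q^{14+6L} E(L) + q^{12+4L}(1 + q^{4+2L}) E(L+1) - q^{6+2L}(q^{3+L} - 1)(1 + q^{3+L}) E(L+2) - (1 + q^{8+2L}) E(L+3) + E(L+4) = 0, and the same recurrence is satisfied by F(L) = ∑_{l=0}^{L} q^{2(T_L - T_l)}. -/

import Mathlib

open Finset

noncomputable def q : RatFunc ℚ := RatFunc.X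

/-- Triangular number `T m = m(m+1)/2`. -/
def T (m : ℤ) : ℤ := m * (m + 1) / 2

/-- The Gaussian binomial coefficient in base `x`:
`C_x(N, n) = (x^{N-n+1};x)_n / (x;x)_n` for `n ≥ 0`, and `0` when out of range
(`n < 0`; for `0 ≤ N < n` the product contains the factor `1 - x^0 = 0`). -/
noncomputable def qbinB (x : RatFunc ℚ) (N n : ℤ) : RatFunc ℚ :=
  if n < 0 then 0
  else ∏ r ∈ Finset.range n.toNat, (1 - x ^ (N - (r : ℤ))) / (1 - x ^ ((r : ℤ) + 1))

/-- Right-hand side of the finite Euler identity: the sum over all `i, j, k ≥ 0`;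
terms with `i > L`, `j > L` or `k > L` vanish, so the ranges capture the full sum. -/
noncomputable def E (L : ℕ) : RatFunc ℚ :=
  ∑ i ∈ Finset.range (L + 1), ∑ j ∈ Finset.range (L + 1), ∑ k ∈ Finset.range (L + 1),
    (-1) ^ j * q ^ (2 * T i + 2 * T j + 2 * T k - i - j) *
      qbinB (q ^ 2) ((L : ℤ) - k) i * qbinB (q ^ 2) ((L : ℤ) - i) j *
      qbinB (q ^ 2) ((L : ℤ) - j) k

/-- Left-hand side of the finite Euler identity. -/
noncomputable def F (L : ℕ) : RatFunc ℚ :=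
  ∑ l ∈ Finset.range (L + 1), q ^ (2 * (T L - T l))


namespace FinEuler

section general
variable {K : Type*} [Field K]

/-- The `q`-factorial `(x;x)_n` (equal to `1` for `n ≤ 0`). -/
def Pq (x : K) (n : ℤ) : K := ∏ r ∈ Finset.range n.toNat, (1 - x ^ ((r : ℤ) + 1))

/-- The reciprocal `q`-factorial `1/(x;x)_n`, extended by `0` to negative `n`. -/
def Dq (x : K) (n : ℤ) : K := if n < 0 then 0 else (Pq x n)⁻¹

/-- The weight `a^i x^{T_i}`. -/
def Wt (x a : K) (i : ℤ) : K := a ^ i * x ^ (T i)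

lemma T_pred (i : ℤ) : T i = T (i - 1) + i := by
  unfold T
  have : i * (i + 1) = (i - 1) * (i - 1 + 1) + i * 2 := by ring
  rw [this, Int.add_mul_ediv_right _ _ (by norm_num)]

lemma Wt_pred (x a : K) (hx : x ≠ 0) (ha : a ≠ 0) (i : ℤ) :
    Wt x a (i - 1) = Wt x a i * (a⁻¹ * (x ^ i)⁻¹) := by
  unfold Wt
  rw [T_pred i, zpow_sub_one₀ ha, zpow_add₀ hx]
  have := zpow_ne_zero i hx
  field_simp

lemma Pq_succ (x : K) (n : ℤ) (hn : 1 ≤ n) : Pq x n = (1 - x ^ n) * Pq x (n - 1) := by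
  obtain ⟨m, rfl⟩ : ∃ m : ℕ, n = m + 1 := ⟨(n - 1).toNat, by omega⟩
  unfold Pq
  have h1 : ((m : ℤ) + 1).toNat = m + 1 := by omega
  have h2 : ((m : ℤ) + 1 - 1).toNat = m := by omega
  rw [h1, h2, Finset.prod_range_succ, mul_comm]

lemma Pq_nonpos (x : K) (n : ℤ) (hn : n ≤ 0) : Pq x n = 1 := by
  unfold Pq
  rw [Int.toNat_of_nonpos hn]; simp

lemma Dq_neg (x : K) (n : ℤ) (hn : n < 0) : Dq x n = 0 := by
  simp [Dq, hn]

lemma Dq_zero (x : K) : Dq x 0 = 1 := by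
  simp [Dq, Pq_nonpos]

lemma Dq_pred (x : K) (hx : ∀ n : ℤ, 1 ≤ n → 1 - x ^ n ≠ 0) (n : ℤ) :
    Dq x (n - 1) = (1 - x ^ n) * Dq x n := by
  rcases lt_trichotomy n 0 with h | h | h
  · rw [Dq_neg _ _ h, Dq_neg _ _ (by omega), mul_zero]
  · subst h; rw [Dq_neg _ _ (by omega)]; simp
  · have := hx n h
    unfold Dq
    rw [if_neg (by omega), if_neg (by omega), Pq_succ x n h, mul_inv]
    field_simp

/-- The summand. -/
def S (x a b c : K) (L i j k : ℤ) : K :=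
  Wt x a i * Wt x b j * Wt x c k * (Pq x (L - k) * Pq x (L - i) * Pq x (L - j)) *
    (Dq x i * Dq x j * Dq x k) * (Dq x (L - k - i) * Dq x (L - i - j) * Dq x (L - j - k))

lemma S_rot (x a b c : K) (L i j k : ℤ) : S x a b c L i j k = S x b c a L j k i := by
  unfold S; ring

/-- The index-free recurrence operator applied to the summand. -/
def R (x a b c : K) (L i j k : ℤ) : K :=
  S x a b c (L + 4) i j k - S x a b c (L + 3) i j k
  - x ^ (L + 4) * (a * S x a b c (L + 3) (i - 1) j k + b * S x a b c (L + 3) i (j - 1) k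
      + c * S x a b c (L + 3) i j (k - 1))
  + x ^ (L + 4) * (x ^ (L + 3) - 1) * (a * b * S x a b c (L + 2) (i - 1) (j - 1) k
      + b * c * S x a b c (L + 2) i (j - 1) (k - 1) + c * a * S x a b c (L + 2) (i - 1) j (k - 1))
  - x ^ (3 * L + 9) * (a * b * c) * S x a b c (L + 1) (i - 1) (j - 1) (k - 1)
  - x ^ (2 * L + 7) * (a * b * c) * (a * S x a b c (L + 1) (i - 2) (j - 1) (k - 1)
      + b * S x a b c (L + 1) (i - 1) (j - 2) (k - 1)
      + c * S x a b c (L + 1) (i - 1) (j - 1) (k - 2))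
  - x ^ (3 * L + 9) * (a * b * c) ^ 2 * S x a b c L (i - 2) (j - 2) (k - 2)

lemma R_rot (x a b c : K) (L i j k : ℤ) : R x a b c L i j k = R x b c a L j k i := by
  unfold R
  simp only [S_rot x a b c]
  ring

lemma Wt_pred2 (x a : K) (hx0 : x ≠ 0) (ha : a ≠ 0) (i : ℤ) :
    Wt x a (i - 2) = Wt x a i * (a⁻¹ * (x ^ i)⁻¹) * (a⁻¹ * (x ^ i)⁻¹ * x) := by
  rw [show i - 2 = i - 1 - 1 by ring, Wt_pred x a hx0 ha, Wt_pred x a hx0 ha, zpow_sub_one₀ hx0]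
  simp only [mul_inv, inv_inv]
  ring

lemma Dq_pred2 (x : K) (hx0 : x ≠ 0) (hx : ∀ n : ℤ, 1 ≤ n → 1 - x ^ n ≠ 0) (i : ℤ) :
    Dq x (i - 2) = (1 - x ^ i * x⁻¹) * (1 - x ^ i) * Dq x i := by
  rw [show i - 2 = i - 1 - 1 by ring, Dq_pred x hx, Dq_pred x hx, zpow_sub_one₀ hx0]
  ring

lemma P3 (x : K) (hx0 : x ≠ 0) (L i : ℤ) (hi : i ≤ L + 2) : Pq x (L + 3 - i) =
    (1 - x ^ L * x ^ 3 * (x ^ i)⁻¹) * Pq x (L + 2 - i) := by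
  rw [Pq_succ x _ (by omega), show L + 3 - i - 1 = L + 2 - i by ring, zpow_sub₀ hx0,
    zpow_add₀ hx0, div_eq_mul_inv]
  norm_cast

lemma P4 (x : K) (hx0 : x ≠ 0) (L i : ℤ) (hi : i ≤ L + 2) : Pq x (L + 4 - i) =
    (1 - x ^ L * x ^ 4 * (x ^ i)⁻¹) * ((1 - x ^ L * x ^ 3 * (x ^ i)⁻¹) * Pq x (L + 2 - i)) := by
  rw [Pq_succ x _ (by omega), show L + 4 - i - 1 = L + 3 - i by ring, P3 x hx0 L i hi,
    zpow_sub₀ hx0, zpow_add₀ hx0, div_eq_mul_inv]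
  norm_cast

lemma D3 (x : K) (hx0 : x ≠ 0) (hx : ∀ n : ℤ, 1 ≤ n → 1 - x ^ n ≠ 0) (L i j : ℤ) :
    Dq x (L + 3 - i - j) =
      (1 - x ^ L * x ^ 4 * (x ^ i)⁻¹ * (x ^ j)⁻¹) * Dq x (L + 4 - i - j) := by
  rw [show L + 3 - i - j = L + 4 - i - j - 1 by ring, Dq_pred x hx, zpow_sub₀ hx0,
    zpow_sub₀ hx0, zpow_add₀ hx0, div_eq_mul_inv, div_eq_mul_inv]
  norm_cast

set_option maxHeartbeats 4000000 in
/-- Explicit form of `R` in terms of base factors. -/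
lemma R_expand (x a b c : K) (hx0 : x ≠ 0) (ha : a ≠ 0) (hb : b ≠ 0) (hc : c ≠ 0)
    (hx : ∀ n : ℤ, 1 ≤ n → 1 - x ^ n ≠ 0) (L i j k : ℤ) {p1 p2 p3 r1 r2 r3 s1 s2 s3 y u v w : K}
    (hp1 : Pq x (L + 2 - i) = p1) (hp2 : Pq x (L + 2 - j) = p2) (hp3 : Pq x (L + 2 - k) = p3)
    (hr1 : Pq x (L + 3 - i) = r1) (hr2 : Pq x (L + 3 - j) = r2) (hr3 : Pq x (L + 3 - k) = r3)
    (hs1 : Pq x (L + 4 - i) = s1) (hs2 : Pq x (L + 4 - j) = s2) (hs3 : Pq x (L + 4 - k) = s3)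
    (hy : x ^ L = y) (hu : x ^ i = u) (hv : x ^ j = v) (hw : x ^ k = w) :
    R x a b c L i j k = Wt x a i * Wt x b j * Wt x c k * (Dq x i * Dq x j * Dq x k) *
      (Dq x (L + 4 - k - i) * Dq x (L + 4 - i - j) * Dq x (L + 4 - j - k)) *
      (s1 * s2 * s3
       - r1 * r2 * r3 * ((1 - y * x ^ 4 * w⁻¹ * u⁻¹) * (1 - y * x ^ 4 * u⁻¹ * v⁻¹)
          * (1 - y * x ^ 4 * v⁻¹ * w⁻¹))
       - y * x ^ 4 * (u⁻¹ * (1 - u) * (1 - y * x ^ 4 * v⁻¹ * w⁻¹) * (s1 * r2 * r3)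
          + v⁻¹ * (1 - v) * (1 - y * x ^ 4 * w⁻¹ * u⁻¹) * (r1 * s2 * r3)
          + w⁻¹ * (1 - w) * (1 - y * x ^ 4 * u⁻¹ * v⁻¹) * (r1 * r2 * s3))
       + y * x ^ 4 * (y * x ^ 3 - 1) * (
          u⁻¹ * (1 - u) * (v⁻¹ * (1 - v)) * (1 - y * x ^ 4 * w⁻¹ * u⁻¹)
            * (1 - y * x ^ 4 * v⁻¹ * w⁻¹) * (r1 * r2 * p3)
          + v⁻¹ * (1 - v) * (w⁻¹ * (1 - w)) * (1 - y * x ^ 4 * w⁻¹ * u⁻¹)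
            * (1 - y * x ^ 4 * u⁻¹ * v⁻¹) * (p1 * r2 * r3)
          + w⁻¹ * (1 - w) * (u⁻¹ * (1 - u)) * (1 - y * x ^ 4 * u⁻¹ * v⁻¹)
            * (1 - y * x ^ 4 * v⁻¹ * w⁻¹) * (r1 * p2 * r3))
       - y ^ 3 * x ^ 9 * (u⁻¹ * (1 - u) * (v⁻¹ * (1 - v)) * (w⁻¹ * (1 - w)))
          * ((1 - y * x ^ 4 * w⁻¹ * u⁻¹) * (1 - y * x ^ 4 * u⁻¹ * v⁻¹)
          * (1 - y * x ^ 4 * v⁻¹ * w⁻¹)) * (p1 * p2 * p3)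
       - y ^ 2 * x ^ 7 * (u⁻¹ * (1 - u) * (v⁻¹ * (1 - v)) * (w⁻¹ * (1 - w))) * (
          u⁻¹ * (x - u) * (1 - y * x ^ 4 * v⁻¹ * w⁻¹) * (r1 * p2 * p3)
          + v⁻¹ * (x - v) * (1 - y * x ^ 4 * w⁻¹ * u⁻¹) * (p1 * r2 * p3)
          + w⁻¹ * (x - w) * (1 - y * x ^ 4 * u⁻¹ * v⁻¹) * (p1 * p2 * r3))
       - y ^ 3 * x ^ 9 * (u⁻¹ * (1 - u) * (v⁻¹ * (1 - v)) * (w⁻¹ * (1 - w))) *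
          (u⁻¹ * (x - u) * (v⁻¹ * (x - v)) * (w⁻¹ * (x - w))) * (p1 * p2 * p3)) := by
  have hu0 : u ≠ 0 := hu ▸ zpow_ne_zero i hx0
  have hv0 : v ≠ 0 := hv ▸ zpow_ne_zero j hx0
  have hw0 : w ≠ 0 := hw ▸ zpow_ne_zero k hx0
  have e1 : ∀ i : ℤ, L + 3 - (i - 1) = L + 4 - i := by intro i; ring
  have e2 : ∀ i : ℤ, L + 2 - (i - 1) = L + 3 - i := by intro i; ring
  have e3 : ∀ i : ℤ, L + 1 - (i - 1) = L + 2 - i := by intro i; ring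
  have e4 : ∀ i : ℤ, L + 1 - (i - 2) = L + 3 - i := by intro i; ring
  have e5 : ∀ i : ℤ, L - (i - 2) = L + 2 - i := by intro i; ring
  have f1 : ∀ i j : ℤ, L + 3 - i - (j - 1) = L + 4 - i - j := by intro i j; ring
  have f2 : ∀ i j : ℤ, L + 2 - i - (j - 1) = L + 3 - i - j := by intro i j; ring
  have f3 : ∀ i j : ℤ, L + 2 - i - (j - 2) = L + 4 - i - j := by intro i j; ring
  have g3 : x ^ (L + 3) = x ^ L * x ^ 3 := by rw [zpow_add₀ hx0]; norm_cast
  have g4 : x ^ (L + 4) = x ^ L * x ^ 4 := by rw [zpow_add₀ hx0]; norm_cast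
  have g7 : x ^ (2 * L + 7) = (x ^ L) ^ 2 * x ^ 7 := by
    rw [zpow_add₀ hx0, mul_comm 2 L, zpow_mul]; norm_cast
  have g9 : x ^ (3 * L + 9) = (x ^ L) ^ 3 * x ^ 9 := by
    rw [zpow_add₀ hx0, mul_comm 3 L, zpow_mul]; norm_cast
  unfold R S
  simp only [e1, e2, e3, e4, e5, f1, f2, f3, g3, g4, g7, g9]
  simp only [Wt_pred2 x a hx0 ha, Wt_pred2 x b hx0 hb, Wt_pred2 x c hx0 hc, Wt_pred x a hx0 ha,
    Wt_pred x b hx0 hb, Wt_pred x c hx0 hc, Dq_pred2 x hx0 hx, D3 x hx0 hx,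
    Dq_pred x hx i, Dq_pred x hx j, Dq_pred x hx k, hp1, hp2, hp3, hr1, hr2, hr3, hs1, hs2, hs3,
    hy, hu, hv, hw]
  generalize Dq x (L + 4 - k - i) = d1
  generalize Dq x (L + 4 - i - j) = d2
  generalize Dq x (L + 4 - j - k) = d3
  generalize Dq x i = d4
  generalize Dq x j = d5
  generalize Dq x k = d6
  generalize Wt x a i = w1
  generalize Wt x b j = w2
  generalize Wt x c k = w3
  field_simp

set_option maxHeartbeats 4000000 in
lemma R_main (x a b c : K) (hx0 : x ≠ 0) (ha : a ≠ 0) (hb : b ≠ 0) (hc : c ≠ 0)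
    (hx : ∀ n : ℤ, 1 ≤ n → 1 - x ^ n ≠ 0) (L i j k : ℤ)
    (hi : i ≤ L + 2) (hj : j ≤ L + 2) (hk : k ≤ L + 2) : R x a b c L i j k = 0 := by
  rw [R_expand x a b c hx0 ha hb hc hx L i j k rfl rfl rfl
    (P3 x hx0 L i hi) (P3 x hx0 L j hj) (P3 x hx0 L k hk)
    (P4 x hx0 L i hi) (P4 x hx0 L j hj) (P4 x hx0 L k hk) rfl rfl rfl rfl]
  refine mul_eq_zero_of_right _ ?_
  have hu := zpow_ne_zero i hx0
  have hv := zpow_ne_zero j hx0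
  have hw := zpow_ne_zero k hx0
  generalize Pq x (L + 2 - i) = p1
  generalize Pq x (L + 2 - j) = p2
  generalize Pq x (L + 2 - k) = p3
  generalize x ^ i = u at *
  generalize x ^ j = v at *
  generalize x ^ k = w at *
  generalize x ^ L = y at *
  field_simp
  ring

set_option maxHeartbeats 4000000 in
lemma R_corner (x a b c : K) (hx0 : x ≠ 0) (ha : a ≠ 0) (hb : b ≠ 0) (hc : c ≠ 0)
    (hx : ∀ n : ℤ, 1 ≤ n → 1 - x ^ n ≠ 0) (L i j k : ℤ) (hL : 0 ≤ L)
    (hk : L + 3 ≤ k) : R x a b c L i j k = 0 := by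
  rcases lt_or_ge i 0 with h | hi0
  · rw [R_expand x a b c hx0 ha hb hc hx L i j k rfl rfl rfl rfl rfl rfl rfl rfl rfl rfl rfl rfl rfl,
      Dq_neg x i h]
    simp only [zero_mul, mul_zero]
  rcases lt_or_ge j 0 with h | hj0
  · rw [R_expand x a b c hx0 ha hb hc hx L i j k rfl rfl rfl rfl rfl rfl rfl rfl rfl rfl rfl rfl rfl,
      Dq_neg x j h]
    simp only [zero_mul, mul_zero]
  rcases lt_or_ge (L + 4 - k - i) 0 with h | hi1
  · rw [R_expand x a b c hx0 ha hb hc hx L i j k rfl rfl rfl rfl rfl rfl rfl rfl rfl rfl rfl rfl rfl,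
      Dq_neg x _ h]
    simp only [zero_mul, mul_zero]
  rcases lt_or_ge (L + 4 - j - k) 0 with h | hj1
  · rw [R_expand x a b c hx0 ha hb hc hx L i j k rfl rfl rfl rfl rfl rfl rfl rfl rfl rfl rfl rfl rfl,
      Dq_neg x _ h]
    simp only [zero_mul, mul_zero]
  have hPk : ∀ n : ℤ, n ≤ 0 → Pq x n = 1 := Pq_nonpos x
  have hP1 : Pq x 1 = 1 - x := by
    rw [Pq_succ x 1 le_rfl, hPk _ (by norm_num)]; simp
  have hy := zpow_ne_zero L hx0
  have hkk : k = L + 3 ∨ k = L + 4 := by omega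
  rcases hkk with rfl | rfl
  · have hii : i = 0 ∨ i = 1 := by omega
    have hjj : j = 0 ∨ j = 1 := by omega
    have hw : x ^ (L + 3) = x ^ L * x ^ 3 := by rw [zpow_add₀ hx0]; norm_cast
    rw [R_expand x a b c hx0 ha hb hc hx L i j (L + 3) rfl rfl (hPk _ (by omega))
      (P3 x hx0 L i (by omega)) (P3 x hx0 L j (by omega)) (hPk _ (by omega))
      (P4 x hx0 L i (by omega)) (P4 x hx0 L j (by omega))
      (show Pq x (L + 4 - (L + 3)) = 1 - x by rw [← hP1]; congr 1; ring) rfl rfl rfl hw]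
    refine mul_eq_zero_of_right _ ?_
    rcases hii with rfl | rfl <;> rcases hjj with rfl | rfl <;>
      simp only [zpow_zero, zpow_one] <;> field_simp <;> ring
  · have hii : i = 0 := by omega
    have hjj : j = 0 := by omega
    subst hii hjj
    have hw : x ^ (L + 4) = x ^ L * x ^ 4 := by rw [zpow_add₀ hx0]; norm_cast
    rw [R_expand x a b c hx0 ha hb hc hx L 0 0 (L + 4) rfl rfl (hPk _ (by omega))
      (P3 x hx0 L 0 (by omega)) (P3 x hx0 L 0 (by omega)) (hPk _ (by omega))
      (P4 x hx0 L 0 (by omega)) (P4 x hx0 L 0 (by omega)) (hPk _ (by omega)) rfl rfl rfl hw]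
    refine mul_eq_zero_of_right _ ?_
    simp only [zpow_zero]
    field_simp
    ring

lemma R_zero (x a b c : K) (hx0 : x ≠ 0) (ha : a ≠ 0) (hb : b ≠ 0) (hc : c ≠ 0)
    (hx : ∀ n : ℤ, 1 ≤ n → 1 - x ^ n ≠ 0) (L i j k : ℤ) (hL : 0 ≤ L) :
    R x a b c L i j k = 0 := by
  by_cases hk : L + 3 ≤ k
  · exact R_corner x a b c hx0 ha hb hc hx L i j k hL hk
  by_cases hi : L + 3 ≤ i
  · rw [R_rot]; exact R_corner x b c a hx0 hb hc ha hx L j k i hL hi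
  by_cases hj : L + 3 ≤ j
  · rw [R_rot, R_rot]; exact R_corner x c a b hx0 hc ha hb hx L k i j hL hj
  exact R_main x a b c hx0 ha hb hc hx L i j k (by omega) (by omega) (by omega)

lemma S_zero_i (x a b c : K) (L i j k : ℤ) (h : i < 0 ∨ L < i) : S x a b c L i j k = 0 := by
  unfold S
  by_cases hi : i < 0
  · rw [Dq_neg x i hi]; simp only [zero_mul, mul_zero]
  by_cases hk : k < 0
  · rw [Dq_neg x k hk]; simp only [zero_mul, mul_zero]
  rw [Dq_neg x (L - k - i) (by omega)]; simp only [zero_mul, mul_zero]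

lemma S_zero_j (x a b c : K) (L i j k : ℤ) (h : j < 0 ∨ L < j) : S x a b c L i j k = 0 := by
  rw [S_rot]; exact S_zero_i x b c a L j k i h

lemma S_zero_k (x a b c : K) (L i j k : ℤ) (h : k < 0 ∨ L < k) : S x a b c L i j k = 0 := by
  rw [S_rot]; exact S_zero_j x b c a L j k i h

lemma shift_sum (f : ℤ → K) (n : ℕ) (m s : ℤ) (hs : 0 ≤ s) (hm : n + s ≤ m)
    (hf : ∀ i, (i < 0 ∨ (n : ℤ) < i) → f i = 0) :
    ∑ i ∈ Finset.Icc 0 m, f (i - s) = ∑ i ∈ Finset.range (n + 1), f (i : ℤ) := by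
  have h1 : ∑ i ∈ Finset.range (n + 1), f (i : ℤ) =
      ∑ z ∈ (Finset.range (n + 1)).image (fun i : ℕ => (i : ℤ) + s), f (z - s) := by
    rw [Finset.sum_image]
    · simp
    · intro a _ b _ hab
      simpa using hab
  rw [h1]
  symm
  apply Finset.sum_subset
  · intro z hz
    simp only [Finset.mem_image, Finset.mem_range, Finset.mem_Icc] at hz ⊢
    obtain ⟨i, hi, rfl⟩ := hz
    omega
  · intro z hz hz'
    apply hf
    by_contra hcon
    apply hz'
    simp only [Finset.mem_image, Finset.mem_range]
    exact ⟨(z - s).toNat, by omega, by omega⟩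

/-- The triple sum. -/
def G (x a b c : K) (n : ℕ) : K :=
  ∑ i ∈ Finset.range (n + 1), ∑ j ∈ Finset.range (n + 1), ∑ k ∈ Finset.range (n + 1),
    S x a b c n i j k

lemma G_box (x a b c : K) (n : ℕ) (m s t u N : ℤ) (hN : N = n) (hs : 0 ≤ s) (ht : 0 ≤ t)
    (hu : 0 ≤ u) (hms : n + s ≤ m) (hmt : n + t ≤ m) (hmu : n + u ≤ m) :
    ∑ i ∈ Finset.Icc 0 m, ∑ j ∈ Finset.Icc 0 m, ∑ k ∈ Finset.Icc 0 m,
      S x a b c N (i - s) (j - t) (k - u) = G x a b c n := by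
  subst hN
  unfold G
  have h1 : ∀ i j : ℤ, ∑ k ∈ Finset.Icc 0 m, S x a b c n i j (k - u) =
      ∑ k ∈ Finset.range (n + 1), S x a b c n i j k := fun i j =>
    shift_sum (fun k => S x a b c n i j k) n m u hu hmu (fun k hk => S_zero_k _ _ _ _ _ _ _ _ hk)
  simp only [h1]
  have h2 : ∀ i : ℤ, ∑ j ∈ Finset.Icc 0 m, ∑ k ∈ Finset.range (n + 1), S x a b c n i (j - t) k =
      ∑ j ∈ Finset.range (n + 1), ∑ k ∈ Finset.range (n + 1), S x a b c n i j k := fun i =>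
    shift_sum (fun j => ∑ k ∈ Finset.range (n + 1), S x a b c n i j k) n m t ht hmt
      (fun j hj => Finset.sum_eq_zero fun k _ => S_zero_j _ _ _ _ _ _ _ _ hj)
  simp only [h2]
  exact shift_sum (fun i => ∑ j ∈ Finset.range (n + 1), ∑ k ∈ Finset.range (n + 1),
      S x a b c n i j k) n m s hs hms
      (fun i hi => Finset.sum_eq_zero fun j _ => Finset.sum_eq_zero fun k _ =>
        S_zero_i _ _ _ _ _ _ _ _ hi)

lemma G_rec (x a b c : K) (hx0 : x ≠ 0) (ha : a ≠ 0) (hb : b ≠ 0) (hc : c ≠ 0)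
    (hx : ∀ n : ℤ, 1 ≤ n → 1 - x ^ n ≠ 0) (n : ℕ) :
    G x a b c (n + 4) - G x a b c (n + 3)
    - x ^ (n + 4) * (a * G x a b c (n + 3) + b * G x a b c (n + 3) + c * G x a b c (n + 3))
    + x ^ (n + 4) * (x ^ (n + 3) - 1) * (a * b * G x a b c (n + 2) + b * c * G x a b c (n + 2)
        + c * a * G x a b c (n + 2))
    - x ^ (3 * n + 9) * (a * b * c) * G x a b c (n + 1)
    - x ^ (2 * n + 7) * (a * b * c) * (a * G x a b c (n + 1) + b * G x a b c (n + 1)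
        + c * G x a b c (n + 1))
    - x ^ (3 * n + 9) * (a * b * c) ^ 2 * G x a b c n = 0 := by
  have key : ∑ i ∈ Finset.Icc (0 : ℤ) (n + 6), ∑ j ∈ Finset.Icc (0 : ℤ) (n + 6),
      ∑ k ∈ Finset.Icc (0 : ℤ) (n + 6), R x a b c n (i - 0) (j - 0) (k - 0) = 0 :=
    Finset.sum_eq_zero fun i _ => Finset.sum_eq_zero fun j _ => Finset.sum_eq_zero fun k _ =>
      R_zero x a b c hx0 ha hb hc hx n _ _ _ (by omega)
  have z0 : ∀ i s : ℤ, i - 0 - s = i - s := by intro i s; ring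
  unfold R at key
  simp only [z0, Finset.sum_add_distrib, Finset.sum_sub_distrib, ← Finset.mul_sum] at key
  have q1 : x ^ ((n : ℤ) + 4) = x ^ (n + 4) := by norm_cast
  have q2 : x ^ ((n : ℤ) + 3) = x ^ (n + 3) := by norm_cast
  have q3 : x ^ (3 * (n : ℤ) + 9) = x ^ (3 * n + 9) := by norm_cast
  have q4 : x ^ (2 * (n : ℤ) + 7) = x ^ (2 * n + 7) := by norm_cast
  rw [q1, q2, q3, q4] at key
  have B := G_box x a b c
  rw [B (n + 4) _ 0 0 0 _ (by push_cast; rfl) (by omega) (by omega) (by omega)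
      (by push_cast; omega) (by push_cast; omega) (by push_cast; omega),
    B (n + 3) _ 0 0 0 _ (by push_cast; rfl) (by omega) (by omega) (by omega)
      (by push_cast; omega) (by push_cast; omega) (by push_cast; omega),
    B (n + 3) _ 1 0 0 _ (by push_cast; rfl) (by omega) (by omega) (by omega)
      (by push_cast; omega) (by push_cast; omega) (by push_cast; omega),
    B (n + 3) _ 0 1 0 _ (by push_cast; rfl) (by omega) (by omega) (by omega)
      (by push_cast; omega) (by push_cast; omega) (by push_cast; omega),
    B (n + 3) _ 0 0 1 _ (by push_cast; rfl) (by omega) (by omega) (by omega)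
      (by push_cast; omega) (by push_cast; omega) (by push_cast; omega),
    B (n + 2) _ 1 1 0 _ (by push_cast; rfl) (by omega) (by omega) (by omega)
      (by push_cast; omega) (by push_cast; omega) (by push_cast; omega),
    B (n + 2) _ 0 1 1 _ (by push_cast; rfl) (by omega) (by omega) (by omega)
      (by push_cast; omega) (by push_cast; omega) (by push_cast; omega),
    B (n + 2) _ 1 0 1 _ (by push_cast; rfl) (by omega) (by omega) (by omega)
      (by push_cast; omega) (by push_cast; omega) (by push_cast; omega),
    B (n + 1) _ 1 1 1 _ (by push_cast; rfl) (by omega) (by omega) (by omega)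
      (by push_cast; omega) (by push_cast; omega) (by push_cast; omega),
    B (n + 1) _ 2 1 1 _ (by push_cast; rfl) (by omega) (by omega) (by omega)
      (by push_cast; omega) (by push_cast; omega) (by push_cast; omega),
    B (n + 1) _ 1 2 1 _ (by push_cast; rfl) (by omega) (by omega) (by omega)
      (by push_cast; omega) (by push_cast; omega) (by push_cast; omega),
    B (n + 1) _ 1 1 2 _ (by push_cast; rfl) (by omega) (by omega) (by omega)
      (by push_cast; omega) (by push_cast; omega) (by push_cast; omega),
    B n _ 2 2 2 _ rfl (by omega) (by omega) (by omega)
      (by omega) (by omega) (by omega)] at key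
  exact key

end general

lemma q_ne : q ≠ 0 := RatFunc.X_ne_zero

lemma q_pow_ne (m : ℕ) (hm : m ≠ 0) : (1 : RatFunc ℚ) - q ^ m ≠ 0 := by
  intro h
  have h1 : (algebraMap (Polynomial ℚ) (RatFunc ℚ)) (Polynomial.X ^ m) =
      (algebraMap (Polynomial ℚ) (RatFunc ℚ)) 1 := by
    rw [map_pow, RatFunc.algebraMap_X, map_one]
    exact (sub_eq_zero.mp h).symm
  have h2 := RatFunc.algebraMap_injective ℚ h1
  have h3 := congrArg Polynomial.natDegree h2
  simp at h3
  exact hm h3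

lemma hxq (n : ℤ) (hn : 1 ≤ n) : (1 : RatFunc ℚ) - (q ^ 2) ^ n ≠ 0 := by
  obtain ⟨m, rfl⟩ : ∃ m : ℕ, n = m := ⟨n.toNat, by omega⟩
  rw [zpow_natCast, ← pow_mul]
  exact q_pow_ne _ (by omega)

lemma qbinB_eq (N : ℤ) (hN : 0 ≤ N) (n : ℕ) :
    qbinB (q ^ 2) N n = Pq (q ^ 2) N * Dq (q ^ 2) n * Dq (q ^ 2) (N - n) := by
  unfold qbinB
  rw [if_neg (by omega), Int.toNat_natCast]
  induction n with
  | zero =>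
    have hP : Pq (q ^ 2) N ≠ 0 := Finset.prod_ne_zero_iff.mpr fun r _ => hxq _ (by omega)
    simp only [Finset.range_zero, Finset.prod_empty, Nat.cast_zero, Dq_zero, sub_zero, mul_one]
    rw [Dq, if_neg (by omega), mul_inv_cancel₀ hP]
  | succ n ih =>
    rw [Finset.prod_range_succ, ih]
    have h1 := Dq_pred (q ^ 2) hxq ((n : ℤ) + 1)
    have h2 := Dq_pred (q ^ 2) hxq (N - n)
    have h3 := hxq ((n : ℤ) + 1) (by omega)
    rw [show (n : ℤ) + 1 - 1 = n by ring] at h1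
    push_cast
    rw [show N - ((n : ℤ) + 1) = N - n - 1 by ring, h1, h2]
    field_simp

lemma E_eq (n : ℕ) : E n = G (q ^ 2) q⁻¹ (-q⁻¹) 1 n := by
  unfold E G
  refine Finset.sum_congr rfl fun i hi => Finset.sum_congr rfl fun j hj =>
    Finset.sum_congr rfl fun k hk => ?_
  rw [Finset.mem_range] at hi hj hk
  rw [qbinB_eq _ (by omega), qbinB_eq _ (by omega), qbinB_eq _ (by omega)]
  have hw : (-1 : RatFunc ℚ) ^ j * q ^ (2 * T i + 2 * T j + 2 * T k - i - j) =
      Wt (q ^ 2) q⁻¹ i * Wt (q ^ 2) (-q⁻¹) j * Wt (q ^ 2) 1 k := by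
    unfold Wt
    have hq2 : ∀ t : ℤ, (q ^ 2) ^ t = q ^ (2 * t) := by
      intro t; rw [zpow_mul]; norm_cast
    rw [hq2, hq2, hq2, one_zpow, zpow_natCast (-q⁻¹), neg_pow q⁻¹, zpow_sub₀ q_ne, zpow_sub₀ q_ne,
      zpow_add₀ q_ne, zpow_add₀ q_ne, zpow_natCast, zpow_natCast, zpow_natCast, div_eq_mul_inv,
      div_eq_mul_inv, inv_pow, inv_pow]
    ring
  rw [hw]
  unfold S
  ring

lemma F_succ (n : ℕ) : F (n + 1) = q ^ (2 * (n + 1)) * F n + 1 := by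
  unfold F
  rw [Finset.sum_range_succ, Finset.mul_sum]
  congr 1
  · refine Finset.sum_congr rfl fun l _ => ?_
    have h := T_pred ((n : ℤ) + 1)
    rw [show (n : ℤ) + 1 - 1 = n by ring] at h
    push_cast
    rw [h, ← zpow_natCast, ← zpow_add₀ q_ne]
    congr 1
    push_cast
    ring
  · simp

end FinEuler

/-- The recurrence of order 4 satisfied by both sides of the finite Euler identity. -/
theorem finite_euler_recurrence (L : ℕ) :
    (-(q ^ (14 + 6 * L) * E L) + q ^ (12 + 4 * L) * (1 + q ^ (4 + 2 * L)) * E (L + 1) -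
        q ^ (6 + 2 * L) * (q ^ (3 + L) - 1) * (1 + q ^ (3 + L)) * E (L + 2) -
        (1 + q ^ (8 + 2 * L)) * E (L + 3) + E (L + 4) = 0) ∧
      (-(q ^ (14 + 6 * L) * F L) + q ^ (12 + 4 * L) * (1 + q ^ (4 + 2 * L)) * F (L + 1) -
        q ^ (6 + 2 * L) * (q ^ (3 + L) - 1) * (1 + q ^ (3 + L)) * F (L + 2) -
        (1 + q ^ (8 + 2 * L)) * F (L + 3) + F (L + 4) = 0) := by 
  constructor
  · have h := FinEuler.G_rec (q ^ 2) q⁻¹ (-q⁻¹) 1 (pow_ne_zero 2 FinEuler.q_ne)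
      (inv_ne_zero FinEuler.q_ne) (neg_ne_zero.mpr (inv_ne_zero FinEuler.q_ne)) one_ne_zero
      FinEuler.hxq L
    simp only [← FinEuler.E_eq] at h
    have hq := FinEuler.q_ne
    rw [← h]
    generalize E L = e0
    generalize E (L + 1) = e1
    generalize E (L + 2) = e2
    generalize E (L + 3) = e3
    generalize E (L + 4) = e4
    field_simp
    ring
  · rw [FinEuler.F_succ (L + 3), FinEuler.F_succ (L + 2), FinEuler.F_succ (L + 1),
      FinEuler.F_succ L]
    ring
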